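/- arXiv:math/9809086 — 2 statements merged into one kernel-verified Lean document; each statement's English description precedes it below -/
import Mathlib

section
/- Let q ∈ ℂ be nonzero and not a root of unity, let A be a unital associative ℂ-algebra, and let a, b, c, d ∈ A satisfy the SL_q(2) relations. Set ζ := −q⁻¹bc. Then for every natural number n, $\sum_{k=0}^{n}\binom{n}{k}_{q^2}\,(-q)^{k}\,a^{n-k}c^{k}b^{k}d^{n-k} \;=\; \sum_{m=0}^{n}(-\zeta)^{m}\sum_{k=0}^{m}\binom{n}{k}_{q^2}\,q^{-2k(n-k-1)}\,(-1)^{k}\,q^{-(m-k)(m-k-1)}\binom{n-k}{m-k}_{q^{-2}}$. (This expresses the trace of the projector $e_{-n}$ as an explicit polynomial in ζ with scalar coefficients.) -/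
/-- The `x`-binomial coefficient
`(x-1)(x²-1)⋯(xⁿ-1) / [(x-1)⋯(x^k-1) · (x-1)⋯(x^(n-k)-1)]`. -/
noncomputable def qbin (x : ℂ) (n k : ℕ) : ℂ :=
  (∏ i ∈ Finset.range n, (x ^ (i + 1) - 1)) /
    ((∏ i ∈ Finset.range k, (x ^ (i + 1) - 1)) *
      (∏ i ∈ Finset.range (n - k), (x ^ (i + 1) - 1)))

theorem qbin_zero_right {x : ℂ} (hx : ∀ i : ℕ, x ^ (i + 1) ≠ 1) (n : ℕ) : qbin x n 0 = 1 := by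
  have h : ∏ i ∈ Finset.range n, (x ^ (i + 1) - 1) ≠ 0 :=
    Finset.prod_ne_zero_iff.mpr fun i _ => sub_ne_zero.mpr (hx i)
  simp [qbin, h]

theorem qbin_self {x : ℂ} (hx : ∀ i : ℕ, x ^ (i + 1) ≠ 1) (n : ℕ) : qbin x n n = 1 := by
  have h : ∏ i ∈ Finset.range n, (x ^ (i + 1) - 1) ≠ 0 :=
    Finset.prod_ne_zero_iff.mpr fun i _ => sub_ne_zero.mpr (hx i)
  simp [qbin, h]

/-- The Pascal recursion for `x`-binomial coefficients. -/
theorem qbin_succ_succ {x : ℂ} (hx : ∀ i : ℕ, x ^ (i + 1) ≠ 1) {n l : ℕ} (hl : l < n) :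
    qbin x (n + 1) (l + 1) = qbin x n (l + 1) + x ^ (n - l) * qbin x n l := by
  obtain ⟨r, rfl⟩ := Nat.exists_eq_add_of_lt hl
  have hP (N : ℕ) : ∏ i ∈ Finset.range N, (x ^ (i + 1) - 1) ≠ 0 :=
    Finset.prod_ne_zero_iff.mpr fun i _ => sub_ne_zero.mpr (hx i)
  have e₁ : l + r + 1 + 1 - (l + 1) = r + 1 := by omega
  have e₂ : l + r + 1 - (l + 1) = r := by omega
  have e₃ : l + r + 1 - l = r + 1 := by omega
  simp only [qbin, e₁, e₂, e₃]
  have h₁ := hP l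
  have h₂ := hP r
  have h₃ := sub_ne_zero.mpr (hx l)
  have h₄ := sub_ne_zero.mpr (hx r)
  rw [Finset.prod_range_succ _ (l + r + 1), Finset.prod_range_succ _ l,
    Finset.prod_range_succ _ r]
  field_simp
  ring

theorem pow_mul_pow_of_mul_eq_smul {A : Type*} [Ring A] [Algebra ℂ A] {x : ℂ} {a z : A}
    (h : a * z = x • (z * a)) (N k : ℕ) : a ^ N * z ^ k = x ^ (N * k) • (z ^ k * a ^ N) := by
  have h₁ (k : ℕ) : a * z ^ k = x ^ k • (z ^ k * a) := by
    induction k with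
    | zero => simp
    | succ k ih =>
      rw [pow_succ, ← mul_assoc, ih, smul_mul_assoc, mul_assoc, h, mul_smul_comm, smul_smul,
        ← mul_assoc, ← pow_succ, ← pow_succ]
  induction N with
  | zero => simp
  | succ N ih =>
    rw [pow_succ, mul_assoc, h₁, mul_smul_comm, ← mul_assoc, ih, smul_mul_assoc, smul_smul,
      mul_assoc, ← pow_add]
    congr 2
    ring

/-- The `x`-binomial theorem for `a ^ N * d ^ N`, where `a * d = 1 + z`. -/
theorem pow_mul_pow_eq_sum_qbin {A : Type*} [Ring A] [Algebra ℂ A] {x : ℂ}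
    (hx : ∀ i : ℕ, x ^ (i + 1) ≠ 1) {a d z : A} (h : a * z = x • (z * a))
    (had : a * d = 1 + z) (N : ℕ) :
    a ^ N * d ^ N = ∑ l ∈ Finset.range (N + 1), (x ^ l.choose 2 * qbin x N l) • z ^ l := by
  induction N with
  | zero => simp [qbin]
  | succ N ih =>
    have hstep : a ^ (N + 1) * d ^ (N + 1) = a ^ N * d ^ N + x ^ N • (z * (a ^ N * d ^ N)) := by
      have hz := pow_mul_pow_of_mul_eq_smul h N 1
      rw [pow_one, mul_one] at hz
      rw [pow_succ, pow_succ', mul_assoc, ← mul_assoc a d, had, add_mul, one_mul, mul_add,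
        ← mul_assoc _ z, hz, smul_mul_assoc, mul_assoc]
    rw [hstep, ih, Finset.mul_sum, Finset.smul_sum, Finset.sum_range_succ',
      Finset.sum_range_succ _ N, Finset.sum_range_succ' _ (N + 1), Finset.sum_range_succ _ N]
    have hmid : ∑ l ∈ Finset.range N, (x ^ (l + 1).choose 2 * qbin x (N + 1) (l + 1)) • z ^ (l + 1)
        = ∑ l ∈ Finset.range N, (x ^ (l + 1).choose 2 * qbin x N (l + 1)) • z ^ (l + 1) +
          ∑ l ∈ Finset.range N, x ^ N • (z * (x ^ l.choose 2 * qbin x N l) • z ^ l) := by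
      rw [← Finset.sum_add_distrib]
      refine Finset.sum_congr rfl fun l hl => ?_
      have hlN := Finset.mem_range.mp hl
      rw [qbin_succ_succ hx hlN, mul_smul_comm, ← pow_succ', smul_smul, ← add_smul]
      congr 1
      have e : x ^ N = x ^ (N - l) * x ^ l := by rw [← pow_add, Nat.sub_add_cancel hlN.le]
      rw [e, Nat.choose_succ_succ' l 1, Nat.choose_one_right, pow_add]
      ring
    rw [hmid, qbin_self hx, qbin_self hx, qbin_zero_right hx, qbin_zero_right hx,
      mul_smul_comm, ← pow_succ', smul_smul, Nat.choose_succ_succ' N 1, Nat.choose_one_right,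
      pow_add x N]
    simp only [mul_one]
    abel

theorem stmt6 (q : ℂ) (hq : q ≠ 0) (hroot : ∀ k : ℕ, 0 < k → q ^ k ≠ 1)
    (A : Type*) [Ring A] [Algebra ℂ A] (a b c d : A)
    (hab : a * b = q⁻¹ • (b * a)) (hac : a * c = q⁻¹ • (c * a))
    (hbd : b * d = q⁻¹ • (d * b)) (hbc : b * c = c * b)
    (hcd : c * d = q⁻¹ • (d * c))
    (hadda : a * d - d * a = (q⁻¹ - q) • (b * c))
    (had : a * d - q⁻¹ • (b * c) = 1) (hda : d * a - q • (b * c) = 1)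
    (ζ : A) (hζ : ζ = (-q⁻¹) • (b * c)) (n : ℕ) :
    ∑ k ∈ Finset.range (n + 1),
      (qbin (q ^ 2) n k * (-q) ^ k) • (a ^ (n - k) * c ^ k * b ^ k * d ^ (n - k))
    = ∑ m ∈ Finset.range (n + 1),
        (∑ k ∈ Finset.range (m + 1),
          qbin (q ^ 2) n k * q ^ ((-2 : ℤ) * k * ((n : ℤ) - k - 1)) * (-1 : ℂ) ^ k *
            q ^ (-(((m : ℤ) - k) * ((m : ℤ) - k - 1))) * qbin (q ^ (-2 : ℤ)) (n - k) (m - k)) •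
          (-ζ) ^ m := by
  have hx (i : ℕ) : (q ^ (-2 : ℤ)) ^ (i + 1) ≠ 1 := by
    intro h
    apply hroot (2 * (i + 1)) (by omega)
    rw [zpow_neg, inv_pow, inv_eq_one] at h
    rw [pow_mul]
    exact_mod_cast h
  have hz : -ζ = q⁻¹ • (b * c) := by rw [hζ, neg_smul, neg_neg]
  have haz : a * -ζ = q ^ (-2 : ℤ) • (-ζ * a) := by
    have hba : a * (b * c) = (q⁻¹ * q⁻¹) • (b * c * a) := by
      rw [← mul_assoc, hab, smul_mul_assoc, mul_assoc, hac, mul_smul_comm, smul_smul, mul_assoc]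
    rw [hz, mul_smul_comm, hba, smul_mul_assoc, smul_smul, smul_smul]
    congr 1
    rw [zpow_neg, zpow_ofNat]
    field_simp
  have hadz : a * d = 1 + -ζ := by rw [hz, ← had, sub_add_cancel]
  have hcb (k : ℕ) : c ^ k * b ^ k = q ^ k • (-ζ) ^ k := by
    have hbcz : b * c = q • -ζ := by rw [hz, smul_smul, mul_inv_cancel₀ hq, one_smul]
    rw [← (show Commute c b from hbc.symm).mul_pow, ← hbc, hbcz, smul_pow]
  have hterm (k : ℕ) (hk : k ∈ Finset.range (n + 1)) :
      (qbin (q ^ 2) n k * (-q) ^ k) • (a ^ (n - k) * c ^ k * b ^ k * d ^ (n - k)) =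
        ∑ l ∈ Finset.range (n + 1 - k),
          (qbin (q ^ 2) n k * q ^ ((-2 : ℤ) * k * ((n : ℤ) - k - 1)) * (-1 : ℂ) ^ k *
            q ^ (-((l : ℤ) * ((l : ℤ) - 1))) * qbin (q ^ (-2 : ℤ)) (n - k) l) •
            (-ζ) ^ (k + l) := by
    have hkn : k ≤ n := Nat.lt_succ_iff.mp (Finset.mem_range.mp hk)
    rw [mul_assoc _ (c ^ k), hcb, mul_smul_comm, pow_mul_pow_of_mul_eq_smul haz, smul_mul_assoc,
      smul_mul_assoc, mul_assoc _ (a ^ _), pow_mul_pow_eq_sum_qbin hx haz hadz,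
      Finset.mul_sum, smul_smul, smul_smul, Finset.smul_sum, Nat.succ_sub hkn]
    refine Finset.sum_congr rfl fun l _ => ?_
    rw [mul_smul_comm, smul_smul, ← pow_add]
    congr 1
    have h₁ : (q ^ (-2 : ℤ)) ^ l.choose 2 = q ^ (-((l : ℤ) * ((l : ℤ) - 1))) := by
      rw [← zpow_natCast, ← zpow_mul]
      congr 1
      cases l with
      | zero => simp
      | succ l =>
        have h := Nat.choose_two_right (l + 1)
        have h' : (l + 1).choose 2 * 2 = (l + 1) * l := by
          rw [h]
          exact Nat.div_mul_cancel (Nat.even_mul_pred_self (l + 1)).two_dvd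
        have h'' : (((l + 1).choose 2 : ℕ) : ℤ) * 2 = (l + 1) * l := by exact_mod_cast h'
        push_cast
        linarith
    have h₂ : q ^ k * q ^ k * (q ^ (-2 : ℤ)) ^ ((n - k) * k) =
        q ^ ((-2 : ℤ) * k * ((n : ℤ) - k - 1)) := by
      simp only [← zpow_natCast, ← zpow_mul, ← zpow_add₀ hq]
      congr 1
      push_cast [Nat.cast_sub hkn]
      ring
    rw [h₁, ← h₂, neg_pow]
    ring
  rw [Finset.sum_congr rfl hterm, ← Finset.sum_range_diag_flip (n + 1) fun k l =>
    (qbin (q ^ 2) n k * q ^ ((-2 : ℤ) * k * ((n : ℤ) - k - 1)) * (-1 : ℂ) ^ k *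
      q ^ (-((l : ℤ) * ((l : ℤ) - 1))) * qbin (q ^ (-2 : ℤ)) (n - k) l) • (-ζ) ^ (k + l)]
  refine Finset.sum_congr rfl fun m _ => ?_
  rw [Finset.sum_smul]
  refine Finset.sum_congr rfl fun k hk => ?_
  have hkm : k ≤ m := Nat.lt_succ_iff.mp (Finset.mem_range.mp hk)
  rw [Nat.add_sub_cancel' hkm, Nat.cast_sub hkm]
end

section
/- Let q ∈ ℂ be nonzero and not a root of unity, let A be a unital associative ℂ-algebra, and let a, b, c, d ∈ A satisfy the SL_q(2) relations. For a natural number n, define the matrix $E \in M_{n+1}(A)$ (rows and columns indexed by k, l ∈ {0,…,n}) by $E_{kl} = b^{k}d^{n-k}\,\binom{n}{l}_{q^2}(-q)^{-l}\,a^{n-l}c^{l}$. Then E is idempotent: E·E = E in the matrix ring $M_{n+1}(A)$. (E is the projector matrix $e_{n}$ of the quantum Hopf line bundle of winding number $n$.) -/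
/-- Gaussian binomials defined by the `q`-Pascal recursion, vanishing for `n < k`. -/
def gaussBinom (x : ℂ) : ℕ → ℕ → ℂ
  | _, 0 => 1
  | 0, _ + 1 => 0
  | n + 1, k + 1 => gaussBinom x n (k + 1) + x ^ (n - k) * gaussBinom x n k

lemma gaussBinom_zero_right (x : ℂ) (n : ℕ) : gaussBinom x n 0 = 1 := by
  cases n <;> rfl

lemma gaussBinom_succ_succ (x : ℂ) (n k : ℕ) :
    gaussBinom x (n + 1) (k + 1) =
      gaussBinom x n (k + 1) + x ^ (n - k) * gaussBinom x n k := rfl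

lemma gaussBinom_eq_zero_of_lt (x : ℂ) {n k : ℕ} (h : n < k) : gaussBinom x n k = 0 := by
  induction n generalizing k with
  | zero => cases k with
    | zero => omega
    | succ k => rfl
  | succ n ih => cases k with
    | zero => omega
    | succ k => rw [gaussBinom_succ_succ, ih (by omega), ih (by omega)]; simp

lemma gaussBinom_mul_prod (x : ℂ) (i j : ℕ) :
    gaussBinom x (i + j) i * ((∏ s ∈ Finset.range i, (x ^ (s + 1) - 1)) *
      (∏ s ∈ Finset.range j, (x ^ (s + 1) - 1))) =
      ∏ s ∈ Finset.range (i + j), (x ^ (s + 1) - 1) := by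
  induction hn : i + j generalizing i j with
  | zero =>
    obtain ⟨rfl, rfl⟩ : i = 0 ∧ j = 0 := by omega
    simp [gaussBinom_zero_right]
  | succ n ih =>
    cases i with
    | zero =>
      obtain rfl : j = n + 1 := by omega
      simp [gaussBinom_zero_right]
    | succ k =>
      cases j with
      | zero =>
        obtain rfl : k = n := by omega
        have h := ih k 0 rfl
        rw [gaussBinom_succ_succ, gaussBinom_eq_zero_of_lt x (Nat.lt_succ_self k)]
        simp only [Finset.prod_range_succ, Finset.range_zero, Finset.prod_empty] at h ⊢
        rw [Nat.sub_self]
        linear_combination (x ^ (k + 1) - 1) * h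
      | succ j =>
        have h₁ := ih (k + 1) j (by omega)
        have h₂ := ih k (j + 1) (by omega)
        obtain rfl : n = k + j + 1 := by omega
        rw [gaussBinom_succ_succ, show k + j + 1 - k = j + 1 by omega,
          Finset.prod_range_succ _ j, Finset.prod_range_succ _ (k + j + 1)]
        rw [Finset.prod_range_succ _ j] at h₂
        rw [Finset.prod_range_succ _ k] at h₁ ⊢
        linear_combination (x ^ (j + 1) - 1) * h₁ + x ^ (j + 1) * (x ^ (k + 1) - 1) * h₂

lemma qbin_eq_gaussBinom {x : ℂ} (hx : ∀ k : ℕ, 0 < k → x ^ k ≠ 1) {n k : ℕ} (h : k ≤ n) :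
    qbin x n k = gaussBinom x n k := by
  obtain ⟨j, rfl⟩ := Nat.exists_eq_add_of_le h
  have hP (m : ℕ) : ∏ s ∈ Finset.range m, (x ^ (s + 1) - 1) ≠ 0 :=
    Finset.prod_ne_zero_iff.2 fun s _ => sub_ne_zero.2 (hx _ s.succ_pos)
  rw [qbin, Nat.add_sub_cancel_left, ← gaussBinom_mul_prod,
    mul_div_cancel_right₀ _ (mul_ne_zero (hP _) (hP _))]

section SkewCommute

variable {A : Type*} [Ring A] [Algebra ℂ A]

lemma pow_mul_of_mul_eq_smul {r : ℂ} {a c : A} (h : a * c = r • (c * a)) (m : ℕ) :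
    a ^ m * c = r ^ m • (c * a ^ m) := by
  induction m with
  | zero => simp
  | succ m ih =>
    rw [pow_succ, mul_assoc, h, mul_smul_comm, ← mul_assoc, ih, smul_mul_assoc, smul_smul,
      mul_assoc, ← pow_succ']

lemma mul_pow_of_mul_eq_smul {r : ℂ} {b d : A} (h : b * d = r • (d * b)) (m : ℕ) :
    b * d ^ m = r ^ m • (d ^ m * b) := by
  induction m with
  | zero => simp
  | succ m ih =>
    rw [pow_succ, ← mul_assoc, ih, smul_mul_assoc, mul_assoc, h, mul_smul_comm, smul_smul,
      ← mul_assoc, ← pow_succ]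

/-- The row vector `a^(n-l) c^l` and the column vector `b^l d^(n-l)` pair to `1`. -/
lemma sum_gaussBinom_smul_eq_one {q : ℂ} (hq : q ≠ 0) {a b c d : A}
    (hac : a * c = q⁻¹ • (c * a)) (hbd : b * d = q⁻¹ • (d * b)) (hbc : b * c = c * b)
    (had : a * d - q⁻¹ • (b * c) = 1) (n : ℕ) :
    ∑ l ∈ Finset.range (n + 1), (gaussBinom (q ^ 2) n l * (-q)⁻¹ ^ l) •
      (a ^ (n - l) * c ^ l * (b ^ l * d ^ (n - l))) = 1 := by
  induction n with
  | zero => simp [gaussBinom_zero_right]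
  | succ n ih =>
    set T : ℕ → A := fun l => a ^ (n + 1 - l) * c ^ l * (b ^ l * d ^ (n + 1 - l)) with hT
    have h₁ : ∑ l ∈ Finset.range (n + 2), (gaussBinom (q ^ 2) n l * (-q)⁻¹ ^ l) • T l =
        a * d := by
      rw [Finset.sum_range_succ, gaussBinom_eq_zero_of_lt _ (Nat.lt_succ_self n), zero_mul,
        zero_smul, add_zero]
      calc _ = a * (∑ l ∈ Finset.range (n + 1), (gaussBinom (q ^ 2) n l * (-q)⁻¹ ^ l) •
                (a ^ (n - l) * c ^ l * (b ^ l * d ^ (n - l)))) * d := by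
            rw [Finset.mul_sum, Finset.sum_mul]
            refine Finset.sum_congr rfl fun l hl => ?_
            have hl' : n + 1 - l = n - l + 1 := by
              have := Finset.mem_range.1 hl
              omega
            rw [mul_smul_comm, smul_mul_assoc]
            simp only [hT]
            rw [hl', pow_succ' a, pow_succ d]
            simp only [mul_assoc]
        _ = a * d := by rw [ih, mul_one]
    have h₂ : ∑ l ∈ Finset.range (n + 1),
        ((q ^ 2) ^ (n - l) * gaussBinom (q ^ 2) n l * (-q)⁻¹ ^ (l + 1)) • T (l + 1) =
        (-q)⁻¹ • (c * b) := by
      calc _ = (-q)⁻¹ • (c * (∑ l ∈ Finset.range (n + 1),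
                (gaussBinom (q ^ 2) n l * (-q)⁻¹ ^ l) •
                (a ^ (n - l) * c ^ l * (b ^ l * d ^ (n - l)))) * b) := by
            rw [Finset.mul_sum, Finset.sum_mul, Finset.smul_sum]
            refine Finset.sum_congr rfl fun l _ => ?_
            have hTl : T (l + 1) = (q⁻¹ ^ (n - l) * q⁻¹ ^ (n - l)) •
                (c * (a ^ (n - l) * c ^ l * (b ^ l * d ^ (n - l))) * b) := by
              simp only [hT]
              rw [Nat.add_sub_add_right, pow_succ' c, pow_succ b, ← mul_assoc (a ^ (n - l)),
                pow_mul_of_mul_eq_smul hac, mul_assoc (b ^ l), mul_pow_of_mul_eq_smul hbd]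
              simp only [smul_mul_assoc, mul_smul_comm, smul_smul, mul_assoc]
            rw [hTl, mul_smul_comm, smul_mul_assoc, smul_smul, smul_smul]
            congr 1
            have hqq : (q ^ 2) ^ (n - l) * (q⁻¹ ^ (n - l) * q⁻¹ ^ (n - l)) = 1 := by
              rw [← mul_pow, ← mul_pow]
              field_simp
              simp
            linear_combination gaussBinom (q ^ 2) n l * (-q)⁻¹ ^ (l + 1) * hqq
        _ = (-q)⁻¹ • (c * b) := by rw [ih, mul_one]
    rw [Finset.sum_range_succ', gaussBinom_zero_right] at h₁ ⊢
    calc _ = a * d + (-q)⁻¹ • (c * b) := by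
          rw [← h₁, ← h₂, add_right_comm, ← Finset.sum_add_distrib]
          simp only [gaussBinom_succ_succ, add_mul, add_smul, hT]
      _ = 1 := by rw [← had, hbc, inv_neg, neg_smul, sub_eq_add_neg]

end SkewCommute

theorem stmt13 (q : ℂ) (hq : q ≠ 0) (hroot : ∀ k : ℕ, 0 < k → q ^ k ≠ 1)
    (A : Type*) [Ring A] [Algebra ℂ A] (a b c d : A)
    (hab : a * b = q⁻¹ • (b * a)) (hac : a * c = q⁻¹ • (c * a))
    (hbd : b * d = q⁻¹ • (d * b)) (hbc : b * c = c * b)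
    (hcd : c * d = q⁻¹ • (d * c))
    (hadda : a * d - d * a = (q⁻¹ - q) • (b * c))
    (had : a * d - q⁻¹ • (b * c) = 1) (hda : d * a - q • (b * c) = 1)
    (n : ℕ) (E : Matrix (Fin (n + 1)) (Fin (n + 1)) A)
    (hE : ∀ k l : Fin (n + 1), E k l =
      (qbin (q ^ 2) n l * (-q) ^ (-(l : ℤ))) •
        (b ^ (k : ℕ) * d ^ (n - (k : ℕ)) * a ^ (n - (l : ℕ)) * c ^ (l : ℕ))) :
    E * E = E := by
  have hx : ∀ k : ℕ, 0 < k → (q ^ 2) ^ k ≠ 1 := fun k hk => by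
    rw [← pow_mul]
    exact hroot _ (by omega)
  have hone : ∑ j : Fin (n + 1), (qbin (q ^ 2) n j * (-q) ^ (-(j : ℤ))) •
      (a ^ (n - (j : ℕ)) * c ^ (j : ℕ) * (b ^ (j : ℕ) * d ^ (n - (j : ℕ)))) = 1 := by
    rw [← sum_gaussBinom_smul_eq_one hq hac hbd hbc had n, Finset.sum_range]
    refine Finset.sum_congr rfl fun j _ => ?_
    rw [qbin_eq_gaussBinom hx (Nat.lt_succ_iff.1 j.2), zpow_neg, zpow_natCast, inv_pow]
  ext k l
  rw [Matrix.mul_apply]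
  calc _ = (qbin (q ^ 2) n l * (-q) ^ (-(l : ℤ))) • (b ^ (k : ℕ) * d ^ (n - (k : ℕ)) *
        (∑ j : Fin (n + 1), (qbin (q ^ 2) n j * (-q) ^ (-(j : ℤ))) •
          (a ^ (n - (j : ℕ)) * c ^ (j : ℕ) * (b ^ (j : ℕ) * d ^ (n - (j : ℕ))))) *
        (a ^ (n - (l : ℕ)) * c ^ (l : ℕ))) := by
        rw [Finset.mul_sum, Finset.sum_mul, Finset.smul_sum]
        refine Finset.sum_congr rfl fun j _ => ?_
        rw [hE, hE]
        simp only [smul_mul_assoc, mul_smul_comm, mul_assoc]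
    _ = E k l := by rw [hone, hE, mul_one, ← mul_assoc]
end
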